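/- arXiv:1907.08963 — 4 statements merged into one kernel-verified Lean document; each statement's English description precedes it below -/
import Mathlib

section
/- Let G be a finite simple graph with edge labels f taking values in an additive commutative group M in which x + x = 0 for every x, and let a be a vertex of G. Then the sum over all vertices v ≠ a of the announcement σ_f(v) equals σ_f(a). (Correctness of the scheme M₀: Bob, by XOR-ing all announcements of the nodes other than Alice — including his own keys — recovers exactly Alice's local key k_A = σ_f(a).) -/
open scoped Classical

/-- The announcement of node `v`: the XOR (sum in a group where `x + x = 0`) of the
keys `f e` over all edges `e` of `G` incident to `v`. -/
noncomputable def announcement {V : Type*} [Fintype V] {M : Type*} [AddCommGroup M]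
    (G : SimpleGraph V) (f : Sym2 V → M) (v : V) : M :=
  ∑ e ∈ G.edgeFinset.filter (fun e => v ∈ e), f e

/-- **Correctness of the scheme `M₀`.** If every element of the key group satisfies
`x + x = 0`, then summing the announcements `σ_f(v)` over all vertices `v ≠ a`
recovers exactly Alice's local key `k_A = σ_f(a)`. -/
theorem sum_announcements_ne_eq_announcement {V : Type*} [Fintype V] {M : Type*}
    [AddCommGroup M] (hM : ∀ x : M, x + x = 0) (G : SimpleGraph V) (f : Sym2 V → M)
    (a : V) :
    ∑ v ∈ Finset.univ.filter (fun v => v ≠ a), announcement G f v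
      = announcement G f a := by
  have total : ∑ v : V, announcement G f v = 0 := by
    unfold announcement
    simp only [Finset.sum_filter]
    rw [Finset.sum_comm]
    refine Finset.sum_eq_zero fun e he => ?_
    rw [SimpleGraph.mem_edgeFinset] at he
    induction e using Sym2.ind with
    | _ x y =>
      have hxy : x ≠ y := G.ne_of_adj he
      rw [← Finset.sum_filter]
      have hs : Finset.univ.filter (fun v => v ∈ s(x, y)) = {x, y} := by
        ext v
        simp
      rw [hs, Finset.sum_pair hxy, hM]
  have hsplit := Finset.sum_filter_add_sum_filter_not Finset.univ (fun v => v ≠ a)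
    (fun v => announcement G f v)
  have ha : Finset.univ.filter (fun v => ¬ v ≠ a) = {a} := by
    ext v
    simp
  rw [total, ha, Finset.sum_singleton] at hsplit
  rw [eq_neg_of_add_eq_zero_left hsplit]
  exact neg_eq_of_add_eq_zero_left (hM _)
end

section
/- Let G be a finite simple graph with edge labels f taking values in an additive commutative group M in which x + x = 0 for every x, let a, b be distinct vertices, and let A be a set of vertices with a ∉ A and b ∉ A. Let L_A be the set of edges of G incident to a vertex of A, and suppose a and b are not reachable from each other in the graph obtained from G by deleting the edges of L_A (the attack A is strongest). Let S be the set of vertices reachable from a in G with the edges of L_A deleted. Then Alice's key satisfies σ_f(a) = Σ_{v ∈ S, v ≠ a} σ_f(v) + Σ_{e ∈ ∂S} f(e), where ∂S is the set of edges of G with exactly one endpoint in S, and moreover every edge in ∂S belongs to L_A. (Insecurity of the scheme M₀ under a strongest attack: k_A is determined by the announcements together with the keys known to Eve.) -/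
open scoped Classical

/-- **Insecurity of the scheme `M₀` under a strongest attack.** Suppose the attack `A`
is strongest: Alice `a` and Bob `b` are not reachable after deleting the set `L_A` of
edges incident to `A`. Let `S` be the set of vertices reachable from `a` after deleting
`L_A`, and let `∂S` be the edges of `G` with exactly one endpoint in `S`. Then
`σ_f(a) = Σ_{v ∈ S, v ≠ a} σ_f(v) + Σ_{e ∈ ∂S} f(e)`, and every edge of `∂S` lies
in `L_A`: Alice's key is determined by the announcements and the keys known to Eve. -/
theorem m0_insecure_of_strongest {V : Type*} [Fintype V] {M : Type*} [AddCommGroup M]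
    (hM : ∀ x : M, x + x = 0) (G : SimpleGraph V) (f : Sym2 V → M)
    (a b : V) (hab : a ≠ b) (A : Set V) (ha : a ∉ A) (hb : b ∉ A)
    (LA : Set (Sym2 V)) (hLA : LA = {e : Sym2 V | e ∈ G.edgeSet ∧ ∃ v ∈ A, v ∈ e})
    (hcut : ¬ (G.deleteEdges LA).Reachable a b)
    (S : Finset V) (hS : S = Finset.univ.filter (fun v => (G.deleteEdges LA).Reachable a v))
    (bdry : Finset (Sym2 V))
    (hbdry : bdry = G.edgeFinset.filter (fun e => (∃ v ∈ e, v ∈ S) ∧ ¬ ∀ v ∈ e, v ∈ S)) :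
    announcement G f a
        = (∑ v ∈ S.filter (fun v => v ≠ a), announcement G f v) + ∑ e ∈ bdry, f e
      ∧ ∀ e ∈ bdry, e ∈ LA := by
  have key : ∑ v ∈ S, announcement G f v = ∑ e ∈ bdry, f e := by
    subst hbdry
    unfold announcement
    simp only [Finset.sum_filter]
    rw [Finset.sum_comm]
    refine Finset.sum_congr rfl ?_
    intro e he
    induction e using Sym2.ind with
    | _ x y =>
      have hxy : x ≠ y := by
        have h : G.Adj x y := by simpa using he
        exact h.ne
      have h1 : ∀ v : V, (if v ∈ s(x, y) then f s(x, y) else 0)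
          = (if v = x then f s(x, y) else 0) + (if v = y then f s(x, y) else 0) := by
        intro v
        by_cases h1 : v = x
        · subst h1
          simp [hxy]
        · by_cases h2 : v = y <;> simp [h1, h2, hxy.symm]
      rw [Finset.sum_congr rfl (fun v _ => h1 v), Finset.sum_add_distrib,
        Finset.sum_ite_eq', Finset.sum_ite_eq']
      by_cases hx : x ∈ S <;> by_cases hy : y ∈ S <;> simp [hx, hy, hM]
  have haS : a ∈ S := by
    subst hS
    simp
  constructor
  · rw [← key, Finset.filter_ne', ← Finset.add_sum_erase S _ haS, add_left_comm, hM, add_zero]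
  · intro e he
    subst hbdry
    rw [Finset.mem_filter] at he
    obtain ⟨he, ⟨v, hv, hvS⟩, hn⟩ := he
    push Not at hn
    obtain ⟨w, hw, hwS⟩ := hn
    by_contra hL
    have hne : v ≠ w := fun h => hwS (h ▸ hvS)
    have hee : e = s(v, w) := ((Sym2.mem_and_mem_iff hne).1 ⟨hv, hw⟩)
    subst hee
    have hadj : (G.deleteEdges LA).Adj v w := by
      rw [SimpleGraph.deleteEdges_adj]
      exact ⟨by simpa using he, hL⟩
    rw [hS, Finset.mem_filter] at hvS hwS
    exact hwS ⟨Finset.mem_univ _, hvS.2.trans hadj.reachable⟩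
end

section
/- Let θ ≥ 0, K and K_max be real numbers with 0 ≤ K ≤ K_max, and let E, P : ℕ → ℝ be sequences satisfying E(0) = 0, 0 ≤ P(t) ≤ E(t) for all t, and the key-storage dynamics E(t+1) = E(t) − P(t) + S(t)·K, where S(t) = 1 if E(t) < θ and S(t) = 0 otherwise. Then for all t, 0 ≤ E(t) ≤ θ + K_max. (Lemma 1, key-storage part: under the algorithm's key-generation rule, the key stored on each edge is deterministically bounded by θ + K_max.) -/
/-- **Lemma 1 (key-storage part).** Under the algorithm's key-generation rule — QKD is
active (`S(t) = 1`) exactly when the key storage is below the threshold `θ` — and the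
key-availability constraint `0 ≤ P(t) ≤ E(t)`, the key storage dynamics
`E(t+1) = E(t) − P(t) + S(t)·K` keep `E` deterministically bounded: `0 ≤ E(t) ≤ θ + K_max`. -/
theorem key_storage_bounds (θ K Kmax : ℝ) (hθ : 0 ≤ θ) (hK0 : 0 ≤ K) (hK : K ≤ Kmax)
    (E P : ℕ → ℝ) (hE0 : E 0 = 0)
    (hP : ∀ t, 0 ≤ P t ∧ P t ≤ E t)
    (hdyn : ∀ t, E (t + 1) = E t - P t + (if E t < θ then (1 : ℝ) else 0) * K) :
    ∀ t, 0 ≤ E t ∧ E t ≤ θ + Kmax := by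
  intro t
  induction t with
  | zero => rw [hE0]; constructor <;> linarith
  | succ n ih =>
    obtain ⟨h1, h2⟩ := hP n
    rw [hdyn n]
    split_ifs with h <;> constructor <;> linarith [ih.1, ih.2]
end

section
/- Let δ > 0, βV ≥ 0, D > 0, P_max ≥ 0, and set θ = δβV + P_max. Let P, E, μ, W be real numbers with 0 < P ≤ P_max, E ≤ P, 0 ≤ μ ≤ δP, and 0 ≤ W ≤ βV − D. Then μ·W + (E − θ)·P < 0. (The key-availability constraint is redundant in the algorithm: if consuming P key bits on an edge would violate E ≥ P, then setting that edge's consumption to zero strictly increases the objective G, contradicting optimality.) -/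
/-- **Redundancy of the key-availability constraint.** With the saturation threshold
`θ = δ·βV + P_max`, if consuming `P > 0` key bits on an edge would violate the
availability constraint (`E ≤ P`), then — since the rate satisfies `μ ≤ δP` and the
link weight satisfies `0 ≤ W ≤ βV − D` (with `D = d_max·μ_max`) — the edge's
contribution `μ·W + (E − θ)·P` to the objective `G` is strictly negative, so setting
that edge's consumption to zero strictly increases `G`, contradicting optimality. -/
theorem key_availability_redundant (δ β V D Pmax θ P E μ W : ℝ)
    (hδ : 0 < δ) (hβV : 0 ≤ β * V) (hD : 0 < D) (hPmax : 0 ≤ Pmax)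
    (hθ : θ = δ * (β * V) + Pmax)
    (hP0 : 0 < P) (hPle : P ≤ Pmax) (hE : E ≤ P)
    (hμ0 : 0 ≤ μ) (hμ : μ ≤ δ * P)
    (hW0 : 0 ≤ W) (hW : W ≤ β * V - D) :
    μ * W + (E - θ) * P < 0 := by
  have h1 : μ * W ≤ δ * P * W := mul_le_mul_of_nonneg_right hμ hW0
  have h2 : δ * P * W ≤ δ * P * (β * V - D) :=
    mul_le_mul_of_nonneg_left hW (mul_pos hδ hP0).le
  have h3 : (E - θ) * P ≤ (-(δ * (β * V))) * P :=
    mul_le_mul_of_nonneg_right (by linarith) hP0.le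
  have h4 : 0 < δ * P * D := mul_pos (mul_pos hδ hP0) hD
  have h5 : δ * P * (β * V - D) + (-(δ * (β * V))) * P = -(δ * P * D) := by ring
  linarith
end
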